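/- Every additive system is either indecomposable or a contraction of an indecomposable additive system. -/

import Mathlib

/-- An additive system: a family of sets of nonnegative integers, indexed by a
nonempty set `I`, each containing `0` and having at least two elements, such that
every nonnegative integer has a unique representation as a finitely supported sum
`∑ i, a i` with `a i ∈ A i`. -/
def IsAdditiveSystem {I : Type*} (A : I → Set ℕ) : Prop :=
  Nonempty I ∧ (∀ i, 0 ∈ A i) ∧ (∀ i, (A i).Nontrivial) ∧
    ∀ n : ℕ, ∃! f : I →₀ ℕ, (∀ i, f i ∈ A i) ∧ f.sum (fun _ x => x) = n
/-- The sumset `∑ j ∈ T, B j`: all finitely supported sums of elements `b j ∈ B j`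
with `b j = 0` for `j ∉ T`. -/
def famSum {J : Type*} (B : J → Set ℕ) (T : Set J) : Set ℕ :=
  {n | ∃ f : J →₀ ℕ, (∀ j, f j ∈ B j) ∧ (∀ j, j ∉ T → f j = 0) ∧
    f.sum (fun _ x => x) = n}
/-- `P` is a partition of the index type `J` into pairwise disjoint nonempty sets. -/
def IsPartitionFam {I J : Type*} (P : I → Set J) : Prop :=
  (∀ i, (P i).Nonempty) ∧ (Pairwise fun i i' => Disjoint (P i) (P i')) ∧
    (⋃ i, P i) = Set.univ
/-- `UniqueSumset B C A` means `A = B ⊕ C`: the sumset `B + C` equals `A` and every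
element of `A` has a unique representation `b + c` with `b ∈ B`, `c ∈ C`. -/
def UniqueSumset (B C A : Set ℤ) : Prop :=
  A = {n | ∃ b ∈ B, ∃ c ∈ C, n = b + c} ∧
    ∀ b ∈ B, ∀ c ∈ C, ∀ b' ∈ B, ∀ c' ∈ C, b + c = b' + c' → b = b' ∧ c = c'

/-- A set of integers is decomposable if it is `B ⊕ C` with `|B| ≥ 2` and `|C| ≥ 2`. -/
def DecomposableSet (A : Set ℤ) : Prop :=
  ∃ B C : Set ℤ, B.Nontrivial ∧ C.Nontrivial ∧ UniqueSumset B C A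

/-- A set of integers of prime cardinality is indecomposable. -/
theorem not_decomposableSet_of_prime_ncard {A : Set ℤ} {p : ℕ} (hp : p.Prime)
    (hA : A.ncard = p) : ¬ DecomposableSet A := by
  rintro ⟨B, C, hB, hC, hsum, hinj⟩
  have himage : (fun x : ℤ × ℤ => x.1 + x.2) '' (B ×ˢ C) = A := by
    rw [hsum]
    ext n
    simp only [Set.mem_image, Set.mem_prod, Prod.exists, Set.mem_ofPred_eq]
    grind
  have hinjOn : Set.InjOn (fun x : ℤ × ℤ => x.1 + x.2) (B ×ˢ C) := by
    rintro ⟨b, c⟩ ⟨hb, hc⟩ ⟨b', c'⟩ ⟨hb', hc'⟩ h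
    exact Prod.ext_iff.2 (hinj b hb c hc b' hb' c' hc' h)
  have hcard : B.ncard * C.ncard = p := by
    rw [← Set.ncard_prod, ← hinjOn.ncard_image, himage, hA]
  have one_lt {S : Set ℤ} (hS : S.Nontrivial) (h : S.ncard ≠ 0) : 1 < S.ncard :=
    (Set.one_lt_ncard (Set.finite_of_ncard_ne_zero h)).2 hS
  have hB0 : B.ncard ≠ 0 := by
    intro h
    exact hp.ne_zero (by rw [← hcard, h, zero_mul])
  have hC0 : C.ncard ≠ 0 := by
    intro h
    exact hp.ne_zero (by rw [← hcard, h, mul_zero])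
  exact Nat.not_prime_mul (one_lt hB hB0).ne' (one_lt hC hC0).ne' (hcard ▸ hp)

/-- If `A ⊕ C = ℕ` and `g` is the least number missing from `A`, then `C` consists of
multiples of `g` and `A` is a union of blocks `{g k, …, g k + g - 1}`. -/
theorem dvd_and_mem_iff_of_direct_sum {A C : Set ℕ} (hA0 : 0 ∈ A) (hC0 : 0 ∈ C)
    (hex : ∀ n, ∃ a ∈ A, ∃ c ∈ C, a + c = n)
    (huniq : ∀ a ∈ A, ∀ c ∈ C, ∀ a' ∈ A, ∀ c' ∈ C, a + c = a' + c' → a = a')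
    {g : ℕ} (hg : g ∉ A) (hlt : ∀ r < g, r ∈ A) (n : ℕ) :
    (n ∈ C → g ∣ n) ∧ (n ∈ A ↔ g * (n / g) ∈ A) := by
  have hgpos : 0 < g := Nat.pos_of_ne_zero fun h => hg (h ▸ hA0)
  have hgC : g ∈ C := by
    obtain ⟨a, ha, c, hc, hac⟩ := hex g
    by_cases hcg : c < g
    · have := huniq c (hlt c hcg) 0 hC0 0 hA0 c hc (by omega)
      exact absurd (by simpa [← hac, this] using ha) hg
    · rwa [show g = c by omega]
  have key : ∀ k r, r < g → (g * k + r ∈ C → r = 0) ∧ (g * k + r ∈ A ↔ g * k ∈ A) := by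
    intro k
    induction k using Nat.strong_induction_on with
    | _ k ih =>
      have split (x : ℕ) (hx : x < g * k) : ∃ l < k, ∃ r < g, x = g * l + r :=
        ⟨x / g, Nat.div_lt_of_lt_mul hx, x % g, Nat.mod_lt _ hgpos, (Nat.div_add_mod x g).symm⟩
      have hdvd (c : ℕ) (hc : c ∈ C) (h : c < g * k) : g ∣ c := by
        obtain ⟨l, hl, r, hr, rfl⟩ := split c h
        simp [((ih l hl r hr).1 hc)]
      by_cases hk : g * k ∈ A
      · rcases Nat.eq_zero_or_pos k with rfl | hkpos
        · intro r hr
          simp only [mul_zero, zero_add] at *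
          exact ⟨fun h => huniq r (hlt r hr) 0 hC0 0 hA0 r h (by omega),
            by simp [hlt r hr, hA0]⟩
        have hgk : g ≤ g * k := Nat.le_mul_of_pos_right g hkpos
        have hC (r : ℕ) (hr : r < g) (h : g * k + r ∈ C) : r = 0 := by
          by_contra hr0
          have := huniq (g - r) (hlt _ (by omega)) _ h _ hk g hgC (by omega)
          omega
        intro r hr
        refine ⟨hC r hr, (iff_true_right hk).2 ?_⟩
        obtain ⟨a, ha, c, hc, hac⟩ := hex (g * k + r)
        have hgc : g ∣ c := by
          by_cases h : c < g * k
          · exact hdvd c hc h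
          · obtain ⟨s, rfl⟩ := Nat.exists_eq_add_of_le (not_lt.1 h)
            simp [hC s (by omega) hc]
        obtain ⟨d, rfl⟩ := hgc
        by_cases hd : d = 0
        · subst hd
          simpa [← hac] using ha
        exfalso
        have hdg : g ≤ g * d := Nat.le_mul_of_pos_right g (Nat.pos_of_ne_zero hd)
        obtain ⟨l, hl, s, hs, rfl⟩ := split a (by omega)
        have hsr : s = r := by
          have := congrArg (· % g) hac
          simpa [Nat.add_mod, Nat.mod_eq_of_lt, hs, hr] using this
        subst hsr
        have := huniq _ (((ih l hl s hs).2).1 ha) _ hc _ hk 0 hC0 (by omega)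
        exact hl.ne (Nat.eq_of_mul_eq_mul_left hgpos this)
      · obtain ⟨a, ha, c, hc, hac⟩ := hex (g * k)
        have hgc : g ∣ c := by
          by_cases h : c < g * k
          · exact hdvd c hc h
          · simp [show c = g * k by omega]
        have hane : a ≠ g * k := by
          rintro rfl
          exact hk ha
        have hga : g ∣ a := (Nat.dvd_add_left hgc).1 (hac ▸ dvd_mul_right g k)
        obtain ⟨l, rfl⟩ := hga
        have hl : l < k := Nat.lt_of_mul_lt_mul_left (a := g) (by omega)
        intro r hr
        have har : g * l + r ∈ A := ((ih l hl r hr).2).2 ha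
        refine ⟨fun h => ?_, iff_of_false (fun h => ?_) hk⟩
        · have := huniq _ har c hc 0 hA0 _ h (by omega)
          omega
        · have := huniq _ har c hc _ h 0 hC0 (by omega)
          omega
  have hn := key (n / g) (n % g) (Nat.mod_lt _ hgpos)
  rw [Nat.div_add_mod] at hn
  exact ⟨fun h => Nat.dvd_of_mod_eq_zero (hn.1 h), hn.2⟩

/-- If `A ⊕ C = ℕ` and `1 ∈ A`, then for some prime `p` the set `C` consists of multiples
of `p` and `A` is a union of blocks `{p k, …, p k + p - 1}`. -/
theorem exists_prime_dvd_and_mem_iff_of_direct_sum {A C : Set ℕ} (hA0 : 0 ∈ A) (hC0 : 0 ∈ C)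
    (hA1 : 1 ∈ A) (hex : ∀ n, ∃ a ∈ A, ∃ c ∈ C, a + c = n)
    (huniq : ∀ a ∈ A, ∀ c ∈ C, ∀ a' ∈ A, ∀ c' ∈ C, a + c = a' + c' → a = a') :
    ∃ p : ℕ, p.Prime ∧ ∀ n, (n ∈ C → p ∣ n) ∧ (n ∈ A ↔ p * (n / p) ∈ A) := by
  classical
  by_cases hall : ∀ n, n ∈ A
  · refine ⟨2, Nat.prime_two, fun n => ⟨fun h => ?_, by simp [hall]⟩⟩
    simp [huniq n (hall n) 0 hC0 0 hA0 n h (by omega)]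
  push Not at hall
  have hg := Nat.find_spec hall
  have hlt : ∀ r < Nat.find hall, r ∈ A := fun r hr => not_not.1 (Nat.find_min hall hr)
  set g := Nat.find hall
  have hg1 : g ≠ 1 := fun h => hg (h ▸ hA1)
  refine ⟨g.minFac, Nat.minFac_prime hg1, fun n => ?_⟩
  have hmain := dvd_and_mem_iff_of_direct_sum hA0 hC0 hex huniq hg hlt
  refine ⟨fun h => (Nat.minFac_dvd g).trans ((hmain n).1 h), ?_⟩
  rw [(hmain n).2, (hmain (g.minFac * (n / g.minFac))).2]
  have : g.minFac * (n / g.minFac) / g = n / g := by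
    obtain ⟨q, hq⟩ := Nat.minFac_dvd g
    have hdiv (m : ℕ) : m / g = m / g.minFac / q := by rw [Nat.div_div_eq_div_mul, ← hq]
    rw [hdiv, hdiv, Nat.mul_div_cancel_left _ (Nat.minFac_pos g)]
  rw [this]

/-- An additive system in which the sets `{0}` are permitted. -/
def IsWeakAdditiveSystem {I : Type*} (A : I → Set ℕ) : Prop :=
  (∀ i, 0 ∈ A i) ∧ ∀ n : ℕ, ∃! f : I →₀ ℕ, (∀ i, f i ∈ A i) ∧ f.sum (fun _ x => x) = n

theorem finsupp_sum_add {I : Type*} (f g : I →₀ ℕ) :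
    (f + g).sum (fun _ x => x) = f.sum (fun _ x => x) + g.sum (fun _ x => x) :=
  Finsupp.sum_add_index' (fun _ => rfl) (fun _ _ _ => rfl)

theorem finsupp_sum_single {I : Type*} (i : I) (a : ℕ) :
    (Finsupp.single i a).sum (fun _ x => x) = a :=
  Finsupp.sum_single_index rfl

theorem finsupp_sum_mapRange_mul {I : Type*} (f : I →₀ ℕ) (p : ℕ) :
    (f.mapRange (p * ·) (mul_zero p)).sum (fun _ x => x) = p * f.sum (fun _ x => x) := by
  rw [Finsupp.sum_mapRange_index (fun _ => rfl), Finsupp.mul_sum]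

/-- The common prime factor can be pulled out of a weak additive system: one member is a
union of blocks of length `p` starting at multiples of `p`, all others consist of multiples of
`p`, and the quotients form a weak additive system again. -/
theorem IsWeakAdditiveSystem.exists_quotient {I : Type*} {A : I → Set ℕ}
    (hA : IsWeakAdditiveSystem A) :
    ∃ (p : ℕ) (i₀ : I) (A' : I → Set ℕ), p.Prime ∧ IsWeakAdditiveSystem A' ∧
      ∀ i n, n ∈ A i ↔ (n % p = 0 ∨ i = i₀) ∧ n / p ∈ A' i := by
  classical
  obtain ⟨hzero, hrep⟩ := hA
  have hinj (f g : I →₀ ℕ) (hf : ∀ i, f i ∈ A i) (hg : ∀ i, g i ∈ A i)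
      (h : f.sum (fun _ x => x) = g.sum (fun _ x => x)) : f = g :=
    (hrep _).unique ⟨hf, h⟩ ⟨hg, rfl⟩
  obtain ⟨i₀, hi₀⟩ : ∃ i, 1 ∈ A i := by
    obtain ⟨f, ⟨hf, hsum⟩, -⟩ := hrep 1
    have hne : f ≠ 0 := by
      rintro rfl
      simp at hsum
    obtain ⟨i, hi⟩ := Finsupp.ne_iff.1 hne
    refine ⟨i, ?_⟩
    have hle : f i ≤ 1 := by
      rw [← hsum]
      exact Finset.single_le_sum (f := fun j => f j) (fun _ _ => Nat.zero_le _)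
        (Finsupp.mem_support_iff.2 hi)
    have h1 : f i = 1 := by
      have : f i ≠ 0 := hi
      omega
    exact h1 ▸ hf i
  have hadd (a : ℕ) (ha : a ∈ A i₀) (f : I →₀ ℕ) (hf : ∀ i, f i ∈ A i) (h0 : f i₀ = 0) (i : I) :
      (Finsupp.single i₀ a + f) i ∈ A i := by
    by_cases h : i = i₀
    · subst h
      simpa [h0] using ha
    · simpa [Finsupp.single_apply, Ne.symm h] using hf i
  obtain ⟨p, hp, hblock⟩ := exists_prime_dvd_and_mem_iff_of_direct_sum
    (A := A i₀) (C := famSum A {i₀}ᶜ) (hzero i₀) ⟨0, by simpa using hzero, by simp, by simp⟩ hi₀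
    (by
      intro n
      obtain ⟨f, ⟨hf, hsum⟩, -⟩ := hrep n
      refine ⟨f i₀, hf i₀, _, ⟨f.erase i₀, fun j => ?_, by simp, rfl⟩, ?_⟩
      · by_cases h : j = i₀
        · simpa [h] using hzero i₀
        · simpa [Finsupp.erase_ne h] using hf j
      · conv_rhs => rw [← hsum, ← Finsupp.single_add_erase i₀ f]
        rw [finsupp_sum_add, finsupp_sum_single])
    (by
      rintro a ha _ ⟨f, hf, hf0, rfl⟩ a' ha' _ ⟨f', hf', hf0', rfl⟩ h
      have h0 : f i₀ = 0 := hf0 i₀ (by simp)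
      have h0' : f' i₀ = 0 := hf0' i₀ (by simp)
      have := hinj _ _ (hadd a ha f hf h0) (hadd a' ha' f' hf' h0')
        (by simpa only [finsupp_sum_add, finsupp_sum_single] using h)
      simpa [h0, h0'] using DFunLike.congr_fun this i₀)
  have hother (i : I) (hi : i ≠ i₀) (n : ℕ) (hn : n ∈ A i) : p ∣ n := by
    refine (hblock n).1 ⟨Finsupp.single i n, fun j => ?_, fun j hj => ?_, finsupp_sum_single i n⟩
    · by_cases h : i = j
      · subst h
        simpa using hn
      · simpa [Finsupp.single_apply, h] using hzero j
    · have : j = i₀ := by simpa using hj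
      simp [this, hi]
  refine ⟨p, i₀, fun i => {m | p * m ∈ A i}, hp, ⟨fun i => by simpa using hzero i, fun n => ?_⟩,
    fun i n => ?_⟩
  · obtain ⟨f, ⟨hf, hsum⟩, -⟩ := hrep (p * n)
    have hdvd : ∀ i, p ∣ f i := by
      have hne (i : I) (hi : i ≠ i₀) : p ∣ f i := hother i hi _ (hf i)
      have hrest : p ∣ (f.erase i₀).sum (fun _ x => x) := by
        refine Finset.dvd_sum fun j hj => ?_
        have hj' : j ≠ i₀ := by
          rintro rfl
          simp at hj
        simpa [Finsupp.erase_ne hj'] using hne j hj'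
      have htotal : p ∣ f i₀ + (f.erase i₀).sum (fun _ x => x) := by
        rw [← finsupp_sum_single i₀ (f i₀), ← finsupp_sum_add, Finsupp.single_add_erase, hsum]
        exact dvd_mul_right p n
      intro i
      by_cases hi : i = i₀
      · exact hi ▸ (Nat.dvd_add_left hrest).1 htotal
      · exact hne i hi
    have hmap : (f.mapRange (· / p) (Nat.zero_div p)).mapRange (p * ·) (mul_zero p) = f := by
      ext i
      simpa using Nat.mul_div_cancel' (hdvd i)
    refine ⟨f.mapRange (· / p) (Nat.zero_div p), ⟨fun i => ?_, ?_⟩, ?_⟩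
    · simpa [Nat.mul_div_cancel' (hdvd i)] using hf i
    · refine Nat.eq_of_mul_eq_mul_left hp.pos ?_
      rw [← finsupp_sum_mapRange_mul, hmap, hsum]
    · rintro f' ⟨hf', hsum'⟩
      refine Finsupp.mapRange_injective _ (mul_zero p)
        (fun x y h => Nat.eq_of_mul_eq_mul_left hp.pos h) ?_
      rw [hmap]
      exact hinj _ _ (fun i => by simpa using hf' i) hf
        (by rw [finsupp_sum_mapRange_mul, hsum, hsum'])
  · by_cases hi : i = i₀
    · subst hi
      simpa using (hblock n).2
    · simp only [hi, or_false, Set.mem_ofPred_eq]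
      constructor
      · intro h
        have := hother i hi n h
        exact ⟨Nat.mod_eq_zero_of_dvd this, by rwa [Nat.mul_div_cancel' this]⟩
      · rintro ⟨h0, h⟩
        rwa [Nat.mul_div_cancel' (Nat.dvd_of_mod_eq_zero h0)] at h

section MixedRadix

/-- The `k`-th place value in the mixed radix system with bases `p 0, p 1, …`. -/
def placeValue (p : ℕ → ℕ) (k : ℕ) : ℕ := ∏ j ∈ Finset.range k, p j

/-- The multiples of the `k`-th place value below the next place value. -/
def placeDigits (p : ℕ → ℕ) (k : ℕ) : Set ℕ :=
  {x | placeValue p k ∣ x ∧ x < placeValue p (k + 1)}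

variable {p : ℕ → ℕ}

theorem placeValue_succ (p : ℕ → ℕ) (k : ℕ) : placeValue p (k + 1) = placeValue p k * p k :=
  Finset.prod_range_succ p k

theorem placeValue_dvd {j k : ℕ} (h : j ≤ k) : placeValue p j ∣ placeValue p k :=
  Finset.prod_dvd_prod_of_subset _ _ _ (Finset.range_mono h)

theorem lt_placeValue (hp : ∀ k, 2 ≤ p k) (k : ℕ) : k < placeValue p k := by
  induction k with
  | zero => simp [placeValue]
  | succ k ih =>
    rw [placeValue_succ]
    have := Nat.mul_le_mul_left (placeValue p k) (hp k)
    omega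

theorem mod_placeValue_succ (n k : ℕ) : n % placeValue p (k + 1) =
    n % placeValue p k + placeValue p k * (n / placeValue p k % p k) := by
  rw [placeValue_succ, Nat.mod_mul]

theorem digit_mem_placeDigits (hp : ∀ k, 2 ≤ p k) (n k : ℕ) :
    placeValue p k * (n / placeValue p k % p k) ∈ placeDigits p k := by
  refine ⟨dvd_mul_right _ _, ?_⟩
  have h : n % placeValue p (k + 1) < placeValue p (k + 1) :=
    Nat.mod_lt _ ((Nat.zero_le _).trans_lt (lt_placeValue hp _))
  rw [mod_placeValue_succ] at h
  omega

theorem digit_eq_zero (hp : ∀ k, 2 ≤ p k) {n k : ℕ} (h : n ≤ k) :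
    placeValue p k * (n / placeValue p k % p k) = 0 := by
  simp [Nat.div_eq_of_lt (h.trans_lt (lt_placeValue hp k))]

/-- The mixed radix expansion of `n`, with every digit multiplied by its place value. -/
noncomputable def expansion (hp : ∀ k, 2 ≤ p k) (n : ℕ) : ℕ →₀ ℕ :=
  Finsupp.onFinset (Finset.range n) (fun k => placeValue p k * (n / placeValue p k % p k))
    fun _ hk => Finset.mem_range.2 (not_le.1 fun h => hk (digit_eq_zero hp h))

theorem expansion_apply (hp : ∀ k, 2 ≤ p k) (n k : ℕ) :
    expansion hp n k = placeValue p k * (n / placeValue p k % p k) := rfl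

theorem expansion_sum (hp : ∀ k, 2 ≤ p k) (n : ℕ) :
    (expansion hp n).sum (fun _ x => x) = n := by
  have hsum (m : ℕ) : ∑ k ∈ Finset.range m, placeValue p k * (n / placeValue p k % p k) =
      n % placeValue p m := by
    induction m with
    | zero => simp [placeValue, Nat.mod_one]
    | succ m ih => rw [Finset.sum_range_succ, ih, mod_placeValue_succ]
  rw [expansion, Finsupp.onFinset_sum _ (fun _ => rfl), hsum,
    Nat.mod_eq_of_lt (lt_placeValue hp n)]

theorem eq_expansion (hp : ∀ k, 2 ≤ p k) (f : ℕ →₀ ℕ) (hf : ∀ k, f k ∈ placeDigits p k) :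
    f = expansion hp (f.sum fun _ x => x) := by
  have hpartial (m : ℕ) : ∑ k ∈ Finset.range m, f k < placeValue p m := by
    induction m with
    | zero => simp [placeValue]
    | succ m ih =>
      obtain ⟨⟨d, hd⟩, hlt⟩ := hf m
      rw [Finset.sum_range_succ, hd]
      rw [hd, placeValue_succ] at hlt
      have hdp : d + 1 ≤ p m := Nat.lt_of_mul_lt_mul_left hlt
      have := Nat.mul_le_mul_left (placeValue p m) hdp
      rw [placeValue_succ]
      rw [mul_add] at this
      omega
  have hmod (j m : ℕ) (h : j ≤ m) :
      (∑ k ∈ Finset.range m, f k) % placeValue p j = ∑ k ∈ Finset.range j, f k := by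
    induction m, h using Nat.le_induction with
    | base => exact Nat.mod_eq_of_lt (hpartial j)
    | succ m hm ih =>
      obtain ⟨d, hd⟩ := (placeValue_dvd hm).trans (hf m).1
      rw [Finset.sum_range_succ, hd, Nat.add_mul_mod_self_left, ih]
  obtain ⟨N, hN⟩ : ∃ N, f.support ⊆ Finset.range N := f.support.exists_nat_subset_range
  have htotal (m : ℕ) (h : N ≤ m) : f.sum (fun _ x => x) = ∑ k ∈ Finset.range m, f k :=
    Finsupp.sum_of_support_subset f (hN.trans (Finset.range_mono h)) _ (fun _ _ => rfl)
  ext k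
  have h1 := hmod k (max N (k + 1)) (by omega)
  have h2 := hmod (k + 1) (max N (k + 1)) (by omega)
  rw [← htotal _ (le_max_left _ _)] at h1 h2
  rw [mod_placeValue_succ, Finset.sum_range_succ, h1] at h2
  rw [expansion_apply]
  omega

theorem isAdditiveSystem_placeDigits (hp : ∀ k, 2 ≤ p k) :
    IsAdditiveSystem (placeDigits p) := by
  have hpos (k : ℕ) : 0 < placeValue p k := (Nat.zero_le _).trans_lt (lt_placeValue hp _)
  have h0 (k : ℕ) : 0 ∈ placeDigits p k := ⟨dvd_zero _, hpos _⟩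
  refine ⟨⟨0⟩, h0, fun k => ⟨0, h0 k, placeValue p k, ⟨dvd_rfl, ?_⟩, (hpos k).ne⟩, fun n => ?_⟩
  · rw [placeValue_succ]
    have := Nat.mul_le_mul_left (placeValue p k) (hp k)
    have := hpos k
    omega
  · refine ⟨expansion hp n, ⟨digit_mem_placeDigits hp n, expansion_sum hp n⟩, ?_⟩
    rintro f ⟨hf, rfl⟩
    exact eq_expansion hp f hf

theorem mem_famSum_placeDigits (hp : ∀ k, 2 ≤ p k) (T : Set ℕ) (n : ℕ) :
    n ∈ famSum (placeDigits p) T ↔ ∀ k, n / placeValue p k % p k = 0 ∨ k ∈ T := by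
  constructor
  · rintro ⟨f, hf, hT, rfl⟩ k
    by_cases hk : k ∈ T
    · exact Or.inr hk
    · have := hT k hk
      rw [eq_expansion hp f hf, expansion_apply, mul_eq_zero] at this
      exact Or.inl (this.resolve_left ((Nat.zero_le _).trans_lt (lt_placeValue hp k)).ne')
  · intro h
    refine ⟨expansion hp n, digit_mem_placeDigits hp n, fun k hk => ?_, expansion_sum hp n⟩
    simp [expansion_apply, (h k).resolve_right hk]

theorem not_decomposableSet_placeDigits (hp : ∀ k, (p k).Prime) (k : ℕ) :
    ¬ DecomposableSet (((↑) : ℕ → ℤ) '' placeDigits p k) := by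
  have hpos : 0 < placeValue p k :=
    (Nat.zero_le _).trans_lt (lt_placeValue (fun k => (hp k).two_le) _)
  refine not_decomposableSet_of_prime_ncard (hp k) ?_
  have himage : placeDigits p k =
      (placeValue p k * ·) '' (Finset.range (p k) : Set ℕ) := by
    ext x
    simp only [placeDigits, placeValue_succ, Set.mem_ofPred_eq, Set.mem_image, Finset.coe_range,
      Set.mem_Iio]
    constructor
    · rintro ⟨⟨d, rfl⟩, h⟩
      exact ⟨d, Nat.lt_of_mul_lt_mul_left h, rfl⟩
    · rintro ⟨d, hd, rfl⟩
      exact ⟨dvd_mul_right _ _, Nat.mul_lt_mul_of_pos_left hd hpos⟩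
  rw [Set.ncard_image_of_injective _ Nat.cast_injective, himage,
    Set.ncard_image_of_injective _ fun x y h => Nat.eq_of_mul_eq_mul_left hpos h,
    Set.ncard_coe_finset, Finset.card_range]

end MixedRadix

/-- The members of a weak additive system are described by the mixed radix digits of their
elements, for suitable prime bases. -/
theorem IsWeakAdditiveSystem.exists_prime_bases {I : Type*} {A : I → Set ℕ}
    (hA : IsWeakAdditiveSystem A) :
    ∃ (p : ℕ → ℕ) (c : ℕ → I), (∀ k, (p k).Prime) ∧
      ∀ i n, n ∈ A i ↔ ∀ k, n / placeValue p k % p k = 0 ∨ i = c k := by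
  have step (S : {A : I → Set ℕ // IsWeakAdditiveSystem A}) :
      ∃ (p : ℕ) (i₀ : I) (S' : {A : I → Set ℕ // IsWeakAdditiveSystem A}), p.Prime ∧
        ∀ i n, n ∈ S.1 i ↔ (n % p = 0 ∨ i = i₀) ∧ n / p ∈ S'.1 i := by
    obtain ⟨p, i₀, A', hp, hA', h⟩ := S.2.exists_quotient
    exact ⟨p, i₀, ⟨A', hA'⟩, hp, h⟩
  choose q c next hq hmem using step
  let S (k : ℕ) := next^[k] ⟨A, hA⟩
  have hS (k : ℕ) : S (k + 1) = next (S k) := Function.iterate_succ_apply' next k _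
  refine ⟨fun k => q (S k), fun k => c (S k), fun k => hq _, fun i n => ?_⟩
  set p : ℕ → ℕ := fun k => q (S k)
  have hiter (m : ℕ) : n ∈ A i ↔ (∀ k < m, n / placeValue p k % p k = 0 ∨ i = c (S k)) ∧
      n / placeValue p m ∈ (S m).1 i := by
    induction m with
    | zero => simp [placeValue, S]
    | succ m ih =>
      rw [ih, hmem, placeValue_succ, ← Nat.div_div_eq_div_mul, hS, Nat.forall_lt_succ_right,
        and_assoc]
  constructor
  · intro h k
    exact ((hiter (k + 1)).1 h).1 k (Nat.lt_succ_self k)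
  · intro h
    refine (hiter n).2 ⟨fun k _ => h k, ?_⟩
    rw [Nat.div_eq_of_lt (lt_placeValue (fun k => (hq (S k)).two_le) n)]
    exact (S n).2.1 i

/-- Every additive system is either indecomposable or a contraction of an
indecomposable additive system. -/
theorem additiveSystem_indecomposable_or_contraction {I : Type} (A : I → Set ℕ)
    (hA : IsAdditiveSystem A) :
    (∀ i, ¬ DecomposableSet (((↑) : ℕ → ℤ) '' A i)) ∨
      ∃ (J : Type) (B : J → Set ℕ), IsAdditiveSystem B ∧
        (∀ j, ¬ DecomposableSet (((↑) : ℕ → ℤ) '' B j)) ∧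
        ∃ P : I → Set J, IsPartitionFam P ∧ ∀ i, A i = famSum B (P i) := by
  obtain ⟨-, h0, hnt, hrep⟩ := hA
  obtain ⟨p, c, hp, hmem⟩ := IsWeakAdditiveSystem.exists_prime_bases ⟨h0, hrep⟩
  have hp2 : ∀ k, 2 ≤ p k := fun k => (hp k).two_le
  have hsum (i : I) : A i = famSum (placeDigits p) {k | i = c k} := by
    ext n
    rw [hmem, mem_famSum_placeDigits hp2]
    rfl
  refine Or.inr ⟨ℕ, placeDigits p, isAdditiveSystem_placeDigits hp2,
    not_decomposableSet_placeDigits hp, fun i => {k | i = c k}, ⟨fun i => ?_, ?_, ?_⟩, hsum⟩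
  · obtain ⟨n, hn, hn0⟩ := (hnt i).exists_ne 0
    rw [hsum] at hn
    obtain ⟨f, -, hf, rfl⟩ := hn
    by_contra hempty
    have hf0 : f = 0 := by
      ext k
      exact hf k fun hk => hempty ⟨k, hk⟩
    simp [hf0] at hn0
  · exact fun i i' hne => Set.disjoint_left.2 fun k hk hk' => hne (hk.trans hk'.symm)
  · exact Set.eq_univ_of_forall fun k => Set.mem_iUnion.2 ⟨c k, rfl⟩
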